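/- arXiv:1704.01951 — 5 statements merged into one kernel-verified Lean document; each statement's English description precedes it below -/
import Mathlib

section
/- For every finite vertex set V of size n ≥ 1 and every degree sequence {k_u} on V with k_u ≥ 1 for every vertex u, the graph of loopy-multigraphs G_lm({k_u}) is connected; that is, any two loopy-multigraphs on V with degree sequence {k_u} can be transformed into one another by a finite sequence of double edge swaps, each intermediate graph being a loopy-multigraph with the same degree sequence. -/
/-!
Multiset-based graphs: a graph on `V` is a multiset of unordered pairs (`Sym2 V`).
-/

variable {V : Type*}

/-- Degree of `u`: number of edge-endpoints at `u` (a self-loop at `u` contributes 2). -/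
def mDeg [DecidableEq V] (E : Multiset (Sym2 V)) (u : V) : ℕ :=
  (E.map fun e => if e = s(u, u) then 2 else if u ∈ e then 1 else 0).sum

/-- Loopy-multigraph: every self-loop occurs with multiplicity at most 1
(non-loop pairs may repeat). -/
def IsLoopyMultigraph [DecidableEq V] (E : Multiset (Sym2 V)) : Prop :=
  ∀ u : V, E.count s(u, u) ≤ 1

/-- Multiloop-graph: every non-loop pair occurs with multiplicity at most 1
(self-loops may repeat). -/
def IsMultiloopGraph [DecidableEq V] (E : Multiset (Sym2 V)) : Prop :=
  ∀ u v : V, u ≠ v → E.count s(u, v) ≤ 1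

/-- Double edge swap: remove edges `(u,v)`, `(x,y)` (counted with multiplicity),
add the edges `(u,x)`, `(v,y)`. -/
def DoubleEdgeSwap [DecidableEq V] (E E' : Multiset (Sym2 V)) : Prop :=
  ∃ u v x y : V, ({s(u, v), s(x, y)} : Multiset (Sym2 V)) ≤ E ∧
    E' = E - {s(u, v), s(x, y)} + {s(u, x), s(v, y)}

/-- Adjacency in the graph of graphs on the space of graphs satisfying `P`:
both graphs lie in the space and one is obtained from the other by a single double edge swap. -/
def GogAdj [DecidableEq V] (P : Multiset (Sym2 V) → Prop) (E E' : Multiset (Sym2 V)) : Prop :=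
  P E ∧ P E' ∧ (DoubleEdgeSwap E E' ∨ DoubleEdgeSwap E' E)

/-- The space of loopy-multigraphs with degree sequence `k`. -/
def LMGspace [DecidableEq V] (k : V → ℕ) (E : Multiset (Sym2 V)) : Prop :=
  IsLoopyMultigraph E ∧ ∀ u, mDeg E u = k u

/-- The space of multiloop-graphs with degree sequence `k`. -/
def MLGspace [DecidableEq V] (k : V → ℕ) (E : Multiset (Sym2 V)) : Prop :=
  IsMultiloopGraph E ∧ ∀ u, mDeg E u = k u

/-- Number of self-loops of `E` (counted with multiplicity). -/
def loopCount [DecidableEq V] (E : Multiset (Sym2 V)) : ℕ :=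
  (E.filter fun e => e.IsDiag).card

/-- An open wedge: non-loop edges `(u,v)`, `(u,x)` with `v ≠ x` such that `(v,x)` is not
an edge. -/
def HasOpenWedge [DecidableEq V] (E : Multiset (Sym2 V)) : Prop :=
  ∃ u v x : V, u ≠ v ∧ u ≠ x ∧ v ≠ x ∧ s(u, v) ∈ E ∧ s(u, x) ∈ E ∧ s(v, x) ∉ E

section Degree

variable [DecidableEq V]

theorem mDeg_add (A B : Multiset (Sym2 V)) (u : V) : mDeg (A + B) u = mDeg A u + mDeg B u := by
  simp [mDeg]

theorem mDeg_pos_of_mem {A : Multiset (Sym2 V)} {u v : V} (h : s(u, v) ∈ A) : 0 < mDeg A u := by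
  obtain ⟨C, rfl⟩ := Multiset.exists_cons_of_mem h
  simp only [mDeg, Multiset.map_cons, Multiset.sum_cons, Sym2.mem_mk_left]
  split_ifs <;> omega

theorem exists_mem_of_mDeg_pos {A : Multiset (Sym2 V)} {u : V} (h : 0 < mDeg A u) :
    ∃ v, s(u, v) ∈ A := by
  by_contra! hA
  refine h.ne' (Multiset.sum_eq_zero fun n hn => ?_)
  obtain ⟨e, he, rfl⟩ := Multiset.mem_map.1 hn
  have hu : u ∉ e := fun hu => by
    obtain ⟨v, rfl⟩ := Sym2.mem_iff_exists.1 hu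
    exact hA v he
  rw [if_neg (fun h => hu (by simp [h])), if_neg hu]

theorem mDeg_sub_eq_of_mDeg_eq {E E' : Multiset (Sym2 V)} {u : V} (h : mDeg E u = mDeg E' u) :
    mDeg (E - E') u = mDeg (E' - E) u := by
  have hunion : E - E' + E' = E' - E + E := by
    ext e
    simp only [Multiset.count_add, Multiset.count_sub]
    omega
  have hdeg := congrArg (mDeg · u) hunion
  simp only [mDeg_add] at hdeg
  omega

theorem mDeg_swap {E : Multiset (Sym2 V)} {a b c d : V}
    (h : ({s(a, b), s(c, d)} : Multiset (Sym2 V)) ≤ E) (u : V) :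
    mDeg (E - {s(a, b), s(c, d)} + {s(a, c), s(b, d)}) u = mDeg E u := by
  obtain ⟨F, rfl⟩ := Multiset.le_iff_exists_add.1 h
  rw [add_tsub_cancel_left, mDeg_add, mDeg_add, add_comm]
  congr 1
  simp only [mDeg, Multiset.insert_eq_cons, Multiset.map_cons, Multiset.map_singleton,
    Multiset.sum_cons, Multiset.sum_singleton, Sym2.mem_iff, Sym2.eq_iff]
  grind

end Degree

theorem pair_le_of_mem_of_mem {V : Type*} {E : Multiset (Sym2 V)} {e f : Sym2 V}
    (hef : e ≠ f) (he : e ∈ E) (hf : f ∈ E) :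
    ({e, f} : Multiset (Sym2 V)) ≤ E :=
  (Multiset.le_iff_subset (by simp [hef])).2 (by simp [Multiset.insert_eq_cons, he, hf])

section Swap

variable [DecidableEq V] {k : V → ℕ} {E E' : Multiset (Sym2 V)}

/-- The number of edges, with multiplicity, in which two multigraphs differ. -/
def edgeDist (E E' : Multiset (Sym2 V)) : ℕ := (E - E').card + (E' - E).card

theorem edgeDist_comm (E E' : Multiset (Sym2 V)) : edgeDist E E' = edgeDist E' E :=
  add_comm _ _

theorem GogAdj.symm {P : Multiset (Sym2 V) → Prop} (h : GogAdj P E E') : GogAdj P E' E :=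
  ⟨h.2.1, h.1, h.2.2.symm⟩

theorem notMem_sub_of_mem_sub {e : Sym2 V} (h : e ∈ E - E') : e ∉ E' - E := by
  rw [Multiset.mem_sub] at *
  omega

theorem edgeDist_lt_of_card_sub_lt {E₁ : Multiset (Sym2 V)} (hcard : E₁.card = E.card)
    (h : (E₁ - E').card < (E - E').card) : edgeDist E₁ E' < edgeDist E E' := by
  have key (A : Multiset (Sym2 V)) : (A - E').card + E'.card = (E' - A).card + A.card := by
    rw [← Multiset.card_add, ← Multiset.card_add]
    congr 1
    ext e
    simp only [Multiset.count_add, Multiset.count_sub]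
    omega
  have h₁ := key E₁
  have h₂ := key E
  unfold edgeDist
  omega

theorem exists_gogAdj_edgeDist_lt_of_swap (hE : LMGspace k E) (hE' : LMGspace k E')
    {a b c d : V} (hsub : ({s(a, b), s(c, d)} : Multiset (Sym2 V)) ≤ E - E')
    (hac : s(a, c) ∈ E' - E) (hbd : b = d → s(b, b) ∉ E) :
    ∃ E₁, GogAdj (LMGspace k) E E₁ ∧ edgeDist E₁ E' < edgeDist E E' := by
  have hle : ({s(a, b), s(c, d)} : Multiset (Sym2 V)) ≤ E := hsub.trans (Multiset.sub_le_self _ _)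
  have hcount (e : Sym2 V) := Multiset.le_iff_count.1 hsub e
  simp only [Multiset.count_sub] at hcount
  rw [Multiset.mem_sub] at hac
  set P : Multiset (Sym2 V) := {s(a, b), s(c, d)} with hP
  have hcard : (E - P + {s(a, c), s(b, d)}).card = E.card := by
    have h₂ := Multiset.card_le_card hle
    rw [Multiset.card_add, Multiset.card_sub hle]
    simp only [hP, Multiset.card_pair] at h₂ ⊢
    omega
  refine ⟨E - P + {s(a, c), s(b, d)}, ⟨hE, ⟨fun u => ?_, fun u => ?_⟩, .inl ⟨a, b, c, d, hle, rfl⟩⟩,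
    edgeDist_lt_of_card_sub_lt hcard ?_⟩
  · have hu := hE.1 u
    have hu' := hE'.1 u
    simp only [Multiset.insert_eq_cons, Multiset.count_add, Multiset.count_sub,
      Multiset.count_cons, Multiset.count_singleton]
    have h_loop : s(u, u) = s(b, d) → b = d ∧ u = b := by simp; grind
    by_cases h₁ : s(u, u) = s(a, c) <;> by_cases h₂ : s(u, u) = s(b, d)
    · obtain ⟨rfl, rfl⟩ := h_loop h₂
      obtain ⟨rfl, rfl⟩ : u = a ∧ u = c := by grind
      have := Multiset.mem_of_le hle (by simp [hP] : s(u, u) ∈ P)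
      exact absurd this (hbd rfl)
    · rw [← h₁] at hac
      simp only [if_pos h₁, if_neg h₂]
      omega
    · obtain ⟨rfl, rfl⟩ := h_loop h₂
      have h₀ := Multiset.count_eq_zero.2 (hbd rfl)
      simp only [h₁, if_false, if_true, h₀]
      omega
    · simp only [h₁, h₂, if_false]
      omega
  · rw [mDeg_swap hle, hE.2 u]
  · have hle' : E - P + {s(a, c), s(b, d)} - E' ≤ E - E' - P + {s(b, d)} := by
      refine Multiset.le_iff_count.2 fun e => ?_
      have he := hcount e
      simp only [Multiset.insert_eq_cons, Multiset.count_add, Multiset.count_sub,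
        Multiset.count_cons, Multiset.count_singleton]
      by_cases h₁ : e = s(a, c)
      · subst h₁
        simp only [if_true]
        omega
      · simp only [h₁, if_false]
        omega
    have h₁ := Multiset.card_le_card hle'
    have h₂ := Multiset.card_le_card hsub
    rw [Multiset.card_add, Multiset.card_sub hsub] at h₁
    simp only [hP, Multiset.card_pair, Multiset.card_singleton] at h₁ h₂ ⊢
    omega

/-- Any edge of `E` in excess over `E'` starts an alternating path of length three. -/
theorem exists_alternating_path (hdeg : ∀ u, mDeg E u = mDeg E' u) {u v : V}
    (huv : s(v, u) ∈ E - E') :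
    ∃ w x, s(v, w) ∈ E' - E ∧ ({s(v, u), s(w, x)} : Multiset (Sym2 V)) ≤ E - E' := by
  have hsub (z : V) := mDeg_sub_eq_of_mDeg_eq (hdeg z)
  obtain ⟨w, hvw⟩ := exists_mem_of_mDeg_pos (hsub v ▸ mDeg_pos_of_mem huv)
  have hvw' := notMem_sub_of_mem_sub hvw
  refine ⟨w, ?_⟩
  by_cases hwv : w = v
  · subst hwv
    obtain ⟨F, hF⟩ := Multiset.exists_cons_of_mem huv
    obtain ⟨G, hG⟩ := Multiset.exists_cons_of_mem hvw
    have hwu : w ≠ u := by rintro rfl; exact hvw' huv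
    have h := hsub w
    rw [hF, hG] at h
    simp only [mDeg, Multiset.map_cons, Multiset.sum_cons, Sym2.mem_mk_left, if_true,
      Sym2.congr_right, hwu.symm, if_false] at h
    obtain ⟨x, hx⟩ := exists_mem_of_mDeg_pos (A := F) (u := w) (by unfold mDeg; omega)
    refine ⟨x, hvw, ?_⟩
    rw [hF, Multiset.insert_eq_cons]
    exact Multiset.cons_le_cons _ (Multiset.singleton_le.2 hx)
  · obtain ⟨x, hx⟩ := exists_mem_of_mDeg_pos (A := E - E') (u := w)
      (by rw [hsub]; exact mDeg_pos_of_mem (Sym2.eq_swap ▸ hvw))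
    refine ⟨x, hvw, pair_le_of_mem_of_mem (fun h => ?_) huv hx⟩
    rcases Sym2.eq_iff.1 h with ⟨h, -⟩ | ⟨-, rfl⟩
    · exact hwv h.symm
    · exact hvw' huv

theorem exists_gogAdj_edgeDist_lt_of_mem_sub (hE : LMGspace k E) (hE' : LMGspace k E')
    {e : Sym2 V} (he : e ∈ E - E') :
    (∃ E₁, GogAdj (LMGspace k) E E₁ ∧ edgeDist E₁ E' < edgeDist E E') ∨
      ∃ E₁, GogAdj (LMGspace k) E' E₁ ∧ edgeDist E E₁ < edgeDist E E' := by
  induction e with | h v u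
  have hdeg (z : V) : mDeg E z = mDeg E' z := (hE.2 z).trans (hE'.2 z).symm
  obtain ⟨w, x, hvw, hpair⟩ := exists_alternating_path hdeg he
  by_cases hux : u = x → s(u, u) ∉ E
  · exact .inl (exists_gogAdj_edgeDist_lt_of_swap hE hE' hpair hvw hux)
  obtain ⟨rfl, -⟩ := Classical.not_imp.1 hux
  have hwu : s(w, u) ∈ E - E' := Multiset.mem_of_le hpair (by simp)
  have hvu' := notMem_sub_of_mem_sub he
  have hwu' := notMem_sub_of_mem_sub hwu
  obtain ⟨y, hy⟩ := exists_mem_of_mDeg_pos (A := E' - E) (u := u)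
    (by rw [← mDeg_sub_eq_of_mDeg_eq (hdeg u)]; exact mDeg_pos_of_mem (Sym2.eq_swap ▸ he))
  have hne : s(v, w) ≠ s(u, y) := fun h => by
    rcases Sym2.eq_iff.1 h with ⟨rfl, -⟩ | ⟨rfl, -⟩
    · exact hwu' (Sym2.eq_swap ▸ hvw)
    · exact hvu' (Sym2.eq_swap ▸ hy)
  obtain ⟨E₁, hadj, hlt⟩ := exists_gogAdj_edgeDist_lt_of_swap hE' hE
    (pair_le_of_mem_of_mem hne hvw hy) he
    (fun h => by subst h; exact absurd (Sym2.eq_swap ▸ hy) hwu')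
  refine .inr ⟨E₁, hadj, ?_⟩
  rwa [edgeDist_comm E E₁, edgeDist_comm E E']

theorem exists_gogAdj_edgeDist_lt (hE : LMGspace k E) (hE' : LMGspace k E') (hne : E ≠ E') :
    (∃ E₁, GogAdj (LMGspace k) E E₁ ∧ edgeDist E₁ E' < edgeDist E E') ∨
      ∃ E₁, GogAdj (LMGspace k) E' E₁ ∧ edgeDist E E₁ < edgeDist E E' := by
  by_cases h : E - E' = 0
  · have h' : E' - E ≠ 0 := fun h' =>
      hne (le_antisymm (tsub_eq_zero_iff_le.1 h) (tsub_eq_zero_iff_le.1 h'))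
    obtain ⟨e, he⟩ := Multiset.exists_mem_of_ne_zero h'
    simpa only [edgeDist_comm E', edgeDist_comm _ E, or_comm] using
      exists_gogAdj_edgeDist_lt_of_mem_sub hE' hE he
  · obtain ⟨e, he⟩ := Multiset.exists_mem_of_ne_zero h
    exact exists_gogAdj_edgeDist_lt_of_mem_sub hE hE' he

theorem reflTransGen_gogAdj_LMGspace (hE : LMGspace k E) (hE' : LMGspace k E') :
    Relation.ReflTransGen (GogAdj (LMGspace k)) E E' := by
  induction hn : edgeDist E E' using Nat.strong_induction_on generalizing E E' with
  | _ n ih =>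
    by_cases hne : E = E'
    · rw [hne]
    subst hn
    rcases exists_gogAdj_edgeDist_lt hE hE' hne with ⟨E₁, hadj, hlt⟩ | ⟨E₁, hadj, hlt⟩
    · exact .head hadj (ih _ hlt hadj.2.1 hE' rfl)
    · exact .tail (ih _ hlt hE hadj.2.1 rfl) hadj.symm

end Swap

/-- for every degree sequence on a nonempty finite vertex set with all degrees
at least 1, the graph of loopy-multigraphs is connected: any two loopy-multigraphs with that
degree sequence are joined by a finite sequence of double edge swaps staying in the space. -/
theorem loopy_multigraph_gog_connected {V : Type*} [Fintype V] [DecidableEq V]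
    (hn : 1 ≤ Fintype.card V) (k : V → ℕ) (hk : ∀ u, 1 ≤ k u)
    (E E' : Multiset (Sym2 V)) (hE : LMGspace k E) (hE' : LMGspace k E') :
    Relation.ReflTransGen (GogAdj (LMGspace k)) E E' := by
  exact reflTransGen_gogAdj_LMGspace hE hE'
end

section
/- Every loopy-multigraph G on a finite vertex set V is connected in G_lm({k_u}) (where {k_u} is the degree sequence of G) to a loopy-multigraph containing at most one self-loop: if G has self-loops at two distinct vertices u and v, the double edge swap (u,u),(v,v) ↝ (u,v),(u,v) yields a loopy-multigraph with the same degree sequence and exactly two fewer self-loops, and iterating such swaps reaches a loopy-multigraph with at most one self-loop. -/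
/-!
Multiset-based graphs: a graph on `V` is a multiset of unordered pairs (`Sym2 V`).
-/

variable {V : Type*}

theorem exists_eq_cons_cons_of_loops_mem [DecidableEq V] {E : Multiset (Sym2 V)} {u v : V}
    (huv : u ≠ v) (hu : s(u, u) ∈ E) (hv : s(v, v) ∈ E) :
    ∃ F, E = s(u, u) ::ₘ s(v, v) ::ₘ F := by
  obtain ⟨F, rfl⟩ := Multiset.exists_cons_of_mem hu
  have hv' : s(v, v) ∈ F := by
    rcases Multiset.mem_cons.mp hv with h | h
    · simp_all
    · exact h
  obtain ⟨F', rfl⟩ := Multiset.exists_cons_of_mem hv'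
  exact ⟨F', rfl⟩

theorem cons_cons_sub_pair_add [DecidableEq V] (F : Multiset (Sym2 V)) (a b c d : Sym2 V) :
    a ::ₘ b ::ₘ F - {a, b} + {c, d} = c ::ₘ d ::ₘ F := by
  have h : a ::ₘ b ::ₘ F = F + {a, b} := by
    simp [add_comm F, Multiset.insert_eq_cons]
  rw [h, Multiset.add_sub_cancel_right, add_comm]
  simp [Multiset.insert_eq_cons]

theorem IsLoopyMultigraph.swap_loops [DecidableEq V] {E : Multiset (Sym2 V)}
    (hE : IsLoopyMultigraph E) {u v : V} (huv : u ≠ v) (hu : s(u, u) ∈ E) (hv : s(v, v) ∈ E) :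
    IsLoopyMultigraph (E - {s(u, u), s(v, v)} + {s(u, v), s(u, v)}) := by
  obtain ⟨F, rfl⟩ := exists_eq_cons_cons_of_loops_mem huv hu hv
  rw [cons_cons_sub_pair_add]
  intro w
  have hne : s(w, w) ≠ s(u, v) := by
    intro h
    rcases Sym2.eq_iff.mp h with ⟨rfl, rfl⟩ | ⟨rfl, rfl⟩ <;> exact huv rfl
  rw [Multiset.count_cons_of_ne hne, Multiset.count_cons_of_ne hne]
  exact ((Multiset.count_le_count_cons _ _ _).trans (Multiset.count_le_count_cons _ _ _)).trans
    (hE w)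

theorem mDeg_swap_loops [DecidableEq V] {E : Multiset (Sym2 V)} {u v : V} (huv : u ≠ v)
    (hu : s(u, u) ∈ E) (hv : s(v, v) ∈ E) (w : V) :
    mDeg (E - {s(u, u), s(v, v)} + {s(u, v), s(u, v)}) w = mDeg E w := by
  obtain ⟨F, rfl⟩ := exists_eq_cons_cons_of_loops_mem huv hu hv
  rw [cons_cons_sub_pair_add]
  simp only [mDeg, Multiset.map_cons, Multiset.sum_cons, Sym2.eq_iff, Sym2.mem_iff]
  grind

theorem loopCount_swap_loops_add_two [DecidableEq V] {E : Multiset (Sym2 V)} {u v : V}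
    (huv : u ≠ v) (hu : s(u, u) ∈ E) (hv : s(v, v) ∈ E) :
    loopCount (E - {s(u, u), s(v, v)} + {s(u, v), s(u, v)}) + 2 = loopCount E := by
  obtain ⟨F, rfl⟩ := exists_eq_cons_cons_of_loops_mem huv hu hv
  rw [cons_cons_sub_pair_add]
  simp [loopCount, huv]

theorem IsLoopyMultigraph.exists_loops_of_one_lt_loopCount [DecidableEq V]
    {E : Multiset (Sym2 V)} (hE : IsLoopyMultigraph E) (h : 1 < loopCount E) :
    ∃ u v : V, u ≠ v ∧ s(u, u) ∈ E ∧ s(v, v) ∈ E := by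
  have hnd : (E.filter fun e => e.IsDiag).Nodup := by
    rw [Multiset.nodup_iff_count_le_one]
    intro e
    rw [Multiset.count_filter]
    split_ifs with he
    · induction e with
      | h x y =>
        obtain rfl : x = y := by simpa using he
        exact hE x
    · exact Nat.zero_le _
  obtain ⟨a, ha, b, hb, hab⟩ := Finset.one_lt_card.mp
    (show 1 < (⟨E.filter fun e => e.IsDiag, hnd⟩ : Finset (Sym2 V)).card from h)
  simp only [Finset.mem_mk, Multiset.mem_filter] at ha hb
  induction a with
  | h x y =>
    induction b with
    | h z w =>
      obtain rfl : x = y := by simpa using ha.2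
      obtain rfl : z = w := by simpa using hb.2
      exact ⟨x, z, by rintro rfl; exact hab rfl, ha.1, hb.1⟩

theorem doubleEdgeSwap_loops [DecidableEq V] {E : Multiset (Sym2 V)} {u v : V} (huv : u ≠ v)
    (hu : s(u, u) ∈ E) (hv : s(v, v) ∈ E) :
    DoubleEdgeSwap E (E - {s(u, u), s(v, v)} + {s(u, v), s(u, v)}) := by
  refine ⟨u, u, v, v, ?_, rfl⟩
  obtain ⟨F, rfl⟩ := exists_eq_cons_cons_of_loops_mem huv hu hv
  exact Multiset.cons_le_cons _ (Multiset.cons_le_cons _ (Multiset.zero_le F))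

theorem LMGspace.exists_reflTransGen_loopCount_le_one [DecidableEq V] {k : V → ℕ}
    {E : Multiset (Sym2 V)} (hE : LMGspace k E) :
    ∃ E', Relation.ReflTransGen (GogAdj (LMGspace k)) E E' ∧ loopCount E' ≤ 1 := by
  induction hn : loopCount E using Nat.strong_induction_on generalizing E with
  | _ n ih =>
    by_cases h : loopCount E ≤ 1
    · exact ⟨E, .refl, h⟩
    · obtain ⟨u, v, huv, hu, hv⟩ := hE.1.exists_loops_of_one_lt_loopCount (not_le.mp h)
      have hcount := loopCount_swap_loops_add_two huv hu hv
      have hswap : LMGspace k (E - {s(u, u), s(v, v)} + {s(u, v), s(u, v)}) :=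
        ⟨hE.1.swap_loops huv hu hv, fun w => (mDeg_swap_loops huv hu hv w).trans (hE.2 w)⟩
      obtain ⟨E', hpath, hE'⟩ := ih _ (by omega) hswap rfl
      exact ⟨E', .head ⟨hE, hswap, .inl (doubleEdgeSwap_loops huv hu hv)⟩ hpath, hE'⟩

/-- every loopy-multigraph is connected in the graph of loopy-multigraphs
(with its own degree sequence) to one with at most one self-loop; moreover a double edge
swap on self-loops at two distinct vertices `u`, `v` yields a loopy-multigraph with the
same degree sequence and exactly two fewer self-loops. -/
theorem loopy_multigraph_reduce_loops {V : Type*} [Fintype V] [DecidableEq V]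
    (E : Multiset (Sym2 V)) (hE : IsLoopyMultigraph E) :
    (∀ u v : V, u ≠ v → s(u, u) ∈ E → s(v, v) ∈ E →
      IsLoopyMultigraph (E - {s(u, u), s(v, v)} + {s(u, v), s(u, v)}) ∧
      (∀ w, mDeg (E - {s(u, u), s(v, v)} + {s(u, v), s(u, v)}) w = mDeg E w) ∧
      loopCount (E - {s(u, u), s(v, v)} + {s(u, v), s(u, v)}) + 2 = loopCount E) ∧
    (∃ E' : Multiset (Sym2 V),
      Relation.ReflTransGen (GogAdj (LMGspace (mDeg E))) E E' ∧ loopCount E' ≤ 1) := by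
  exact ⟨fun u v huv hu hv => ⟨hE.swap_loops huv hu hv, mDeg_swap_loops huv hu hv,
      loopCount_swap_loops_add_two huv hu hv⟩,
    LMGspace.exists_reflTransGen_loopCount_le_one ⟨hE, fun _ => rfl⟩⟩
end

section
/- Let G be a multiloop-graph on a finite vertex set V containing an open wedge, i.e. distinct non-loop edges (u,v) and (u,x) with v ≠ x and such that (v,x) is not an edge of G. Then the double edge swap (u,v),(u,x) ↝ (u,u),(v,x) yields a multiloop-graph with the same degree sequence and strictly more self-loops; in particular, any multiloop-graph having the maximum number of self-loops among all multiloop-graphs in its connected component of G_ll contains no open wedge. -/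
/-!
Multiset-based graphs: a graph on `V` is a multiset of unordered pairs (`Sym2 V`).
-/

variable {V : Type*}

/-- The two edges of a wedge are distinct, so both can be removed together. -/
theorem wedge_le [DecidableEq V] {E : Multiset (Sym2 V)} {u v x : V} (hvx : v ≠ x)
    (h1 : s(u, v) ∈ E) (h2 : s(u, x) ∈ E) :
    ({s(u, v), s(u, x)} : Multiset (Sym2 V)) ≤ E := by
  have hne : s(u, v) ≠ s(u, x) := fun h => hvx (Sym2.congr_right.mp h)
  refine (Multiset.le_iff_subset ?_).mpr ?_
  · simpa using hne
  · intro e he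
    simp only [Multiset.insert_eq_cons, Multiset.mem_cons, Multiset.mem_singleton] at he
    rcases he with rfl | rfl <;> assumption

/-- Closing an open wedge preserves multiloop-graphs. -/
theorem IsMultiloopGraph.wedge_swap [DecidableEq V] {E : Multiset (Sym2 V)}
    (hE : IsMultiloopGraph E) (u : V) {v x : V} (h3 : s(v, x) ∉ E) :
    IsMultiloopGraph (E - {s(u, v), s(u, x)} + {s(u, u), s(v, x)}) := by
  intro a b hab
  have hle := Multiset.count_le_of_le s(a, b)
    (tsub_le_self : E - {s(u, v), s(u, x)} ≤ E)
  have hloop : s(a, b) ≠ s(u, u) := fun h => by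
    rcases Sym2.eq_iff.mp h with ⟨rfl, rfl⟩ | ⟨rfl, rfl⟩ <;> exact hab rfl
  have hcount := hE a b hab
  rw [Multiset.count_add, Multiset.insert_eq_cons s(u, u), Multiset.count_cons_of_ne hloop,
    Multiset.count_singleton]
  split_ifs with h
  · rw [h, Multiset.count_eq_zero_of_notMem h3] at hle
    rw [h]
    omega
  · omega

theorem mDeg_add_s8 [DecidableEq V] (E F : Multiset (Sym2 V)) (w : V) :
    mDeg (E + F) w = mDeg E w + mDeg F w := by
  simp [mDeg]

theorem loopCount_add [DecidableEq V] (E F : Multiset (Sym2 V)) :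
    loopCount (E + F) = loopCount E + loopCount F := by
  simp [loopCount]

/-- The pairs `(u,v)`, `(u,x)` and `(u,u)`, `(v,x)` have the same degrees. -/
theorem mDeg_wedge [DecidableEq V] {u v x : V} (huv : u ≠ v) (hux : u ≠ x) (hvx : v ≠ x)
    (w : V) : mDeg {s(u, u), s(v, x)} w = mDeg {s(u, v), s(u, x)} w := by
  simp only [mDeg, Multiset.insert_eq_cons, Multiset.map_cons, Multiset.map_singleton,
    Multiset.sum_cons, Multiset.sum_singleton, Sym2.eq_iff, Sym2.mem_iff]
  grind

theorem mDeg_wedge_swap [DecidableEq V] {E : Multiset (Sym2 V)} {u v x : V}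
    (huv : u ≠ v) (hux : u ≠ x) (hvx : v ≠ x) (h1 : s(u, v) ∈ E) (h2 : s(u, x) ∈ E) (w : V) :
    mDeg (E - {s(u, v), s(u, x)} + {s(u, u), s(v, x)}) w = mDeg E w := by
  rw [mDeg_add_s8, mDeg_wedge huv hux hvx, ← mDeg_add_s8, tsub_add_cancel_of_le (wedge_le hvx h1 h2)]

theorem loopCount_lt_wedge_swap [DecidableEq V] {E : Multiset (Sym2 V)} {u v x : V}
    (huv : u ≠ v) (hux : u ≠ x) (hvx : v ≠ x) (h1 : s(u, v) ∈ E) (h2 : s(u, x) ∈ E) :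
    loopCount E < loopCount (E - {s(u, v), s(u, x)} + {s(u, u), s(v, x)}) := by
  conv_lhs => rw [← tsub_add_cancel_of_le (wedge_le hvx h1 h2)]
  rw [loopCount_add, loopCount_add]
  have hwedge : loopCount ({s(u, v), s(u, x)} : Multiset (Sym2 V)) = 0 := by
    simp [loopCount, Multiset.filter_singleton, huv, hux]
  have hloop : loopCount ({s(u, u), s(v, x)} : Multiset (Sym2 V)) = 1 := by
    simp [loopCount, Multiset.filter_singleton, hvx]
  omega

/-- rewiring an open wedge `(u,v)`, `(u,x)` (with `(v,x)` absent) by the swap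
`(u,v),(u,x) ↝ (u,u),(v,x)` yields a multiloop-graph with the same degree sequence and
strictly more self-loops; consequently a multiloop-graph with the maximum number of
self-loops in its connected component of the gog has no open wedge. -/
theorem wedge_swap_increases_loops {V : Type*} [Fintype V] [DecidableEq V]
    (E : Multiset (Sym2 V)) (hE : IsMultiloopGraph E) (u v x : V)
    (huv : u ≠ v) (hux : u ≠ x) (hvx : v ≠ x)
    (h1 : s(u, v) ∈ E) (h2 : s(u, x) ∈ E) (h3 : s(v, x) ∉ E) :
    (IsMultiloopGraph (E - {s(u, v), s(u, x)} + {s(u, u), s(v, x)}) ∧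
      (∀ w, mDeg (E - {s(u, v), s(u, x)} + {s(u, u), s(v, x)}) w = mDeg E w) ∧
      loopCount E < loopCount (E - {s(u, v), s(u, x)} + {s(u, u), s(v, x)})) ∧
    (∀ E₀ : Multiset (Sym2 V), IsMultiloopGraph E₀ →
      (∀ E₁ : Multiset (Sym2 V),
        Relation.ReflTransGen (GogAdj (MLGspace (mDeg E₀))) E₀ E₁ →
        loopCount E₁ ≤ loopCount E₀) →
      ¬ HasOpenWedge E₀) := by
  refine ⟨⟨hE.wedge_swap u h3, mDeg_wedge_swap huv hux hvx h1 h2,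
    loopCount_lt_wedge_swap huv hux hvx h1 h2⟩, ?_⟩
  rintro E₀ hE₀ hmax ⟨a, b, c, hab, hac, hbc, hb, hc, hn⟩
  refine (loopCount_lt_wedge_swap hab hac hbc hb hc).not_ge (hmax _ (.single ?_))
  exact ⟨⟨hE₀, fun _ => rfl⟩, ⟨hE₀.wedge_swap a hn, mDeg_wedge_swap hab hac hbc hb hc⟩,
    .inl ⟨a, b, a, c, wedge_le hbc hb hc, rfl⟩⟩
end

section
/- Let G be a multiloop-graph on a finite vertex set V whose non-loop edges form a disjoint union of isolated edges and triangles together with self-loops, and suppose G contains both an isolated non-loop edge (p,q) (p and q have no other non-loop neighbors) and a triangle on vertices x, y, z. Then the double edge swap (p,q),(x,y) ↝ (p,x),(q,y) yields a multiloop-graph containing the open wedges p–x–z and q–y–z; consequently G is connected within G_ll to a multiloop-graph with strictly more self-loops. -/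
/-!
Multiset-based graphs: a graph on `V` is a multiset of unordered pairs (`Sym2 V`).
-/

variable {V : Type*}

/-- The contribution of a single edge to the degree of `w` counts its endpoints equal to `w`. -/
lemma ite_edge_endpoints [DecidableEq V] (a b w : V) :
    (if s(a, b) = s(w, w) then 2 else if w ∈ s(a, b) then 1 else 0) =
      (if a = w then 1 else 0) + (if b = w then 1 else 0) := by
  by_cases ha : a = w <;> by_cases hb : b = w <;> simp [ha, hb, eq_comm]

lemma DoubleEdgeSwap.mDeg_eq [DecidableEq V] {E E' : Multiset (Sym2 V)}
    (h : DoubleEdgeSwap E E') (w : V) : mDeg E' w = mDeg E w := by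
  obtain ⟨u, v, x, y, hle, rfl⟩ := h
  obtain ⟨F, rfl⟩ := Multiset.le_iff_exists_add.mp hle
  simp only [mDeg, add_tsub_cancel_left, Multiset.map_add, Multiset.sum_add,
    Multiset.insert_eq_cons, Multiset.map_cons, Multiset.map_singleton, Multiset.sum_cons,
    Multiset.sum_singleton, ite_edge_endpoints]
  ring

lemma IsMultiloopGraph.sub_add_pair [DecidableEq V] {E : Multiset (Sym2 V)}
    (hE : IsMultiloopGraph E) (A : Multiset (Sym2 V)) {e f : Sym2 V}
    (he : e.IsDiag ∨ e ∉ E) (hf : f.IsDiag ∨ f ∉ E) (hef : e ≠ f) :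
    IsMultiloopGraph (E - A + {e, f}) := by
  intro u v huv
  have hnd : ¬ (s(u, v)).IsDiag := by simpa using huv
  have hle := hE u v huv
  simp only [Multiset.count_add, Multiset.count_sub, Multiset.insert_eq_cons,
    Multiset.count_cons, Multiset.count_singleton]
  by_cases h1 : s(u, v) = e
  · have h0 : E.count s(u, v) = 0 := Multiset.count_eq_zero.mpr (by grind)
    have h2 : s(u, v) ≠ f := fun h => hef (h1.symm.trans h)
    rw [if_pos h1, if_neg h2]
    omega
  · rw [if_neg h1]
    by_cases h2 : s(u, v) = f
    · have h0 : E.count s(u, v) = 0 := Multiset.count_eq_zero.mpr (by grind)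
      rw [if_pos h2]
      omega
    · rw [if_neg h2]
      omega

lemma Multiset.mem_sub_pair_of_ne {α : Type*} [DecidableEq α] {E : Multiset α} {a b e : α}
    (he : e ∈ E) (ha : e ≠ a) (hb : e ≠ b) : e ∈ E - {a, b} := by
  rw [← Multiset.count_pos] at he ⊢
  simpa [Multiset.count_sub, Multiset.count_cons, Multiset.count_singleton, ha, hb] using he

lemma Multiset.pair_le_of_mem {α : Type*} [DecidableEq α] {E : Multiset α} {a b : α}
    (ha : a ∈ E) (hb : b ∈ E) (hab : a ≠ b) : ({a, b} : Multiset α) ≤ E := by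
  rw [Multiset.le_iff_subset (by simpa using hab)]
  intro c hc
  simp only [Multiset.insert_eq_cons, Multiset.mem_cons, Multiset.mem_singleton] at hc
  rcases hc with rfl | rfl <;> assumption

/-- Swapping the two edges of an open wedge creates exactly one self-loop. -/
lemma HasOpenWedge.exists_gogAdj_loopCount_eq [DecidableEq V] {E : Multiset (Sym2 V)}
    (hW : HasOpenWedge E) {k : V → ℕ} (hE : MLGspace k E) :
    ∃ E', GogAdj (MLGspace k) E E' ∧ loopCount E' = loopCount E + 1 := by
  obtain ⟨u, v, x, huv, hux, hvx, hv, hx, hvx'⟩ := hW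
  have hle : ({s(u, v), s(u, x)} : Multiset (Sym2 V)) ≤ E :=
    Multiset.pair_le_of_mem hv hx (by simp [hvx, hux])
  have hswap : DoubleEdgeSwap E (E - {s(u, v), s(u, x)} + {s(u, u), s(v, x)}) :=
    ⟨u, v, u, x, hle, rfl⟩
  refine ⟨_, ⟨hE, ⟨hE.1.sub_add_pair _ (.inl (by simp)) (.inr hvx') ?_, fun w =>
    (hswap.mDeg_eq w).trans (hE.2 w)⟩, .inl hswap⟩, ?_⟩
  · simp only [ne_eq, Sym2.eq_iff]
    grind
  · obtain ⟨F, rfl⟩ := Multiset.le_iff_exists_add.mp hle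
    simp [loopCount, Multiset.filter_singleton, huv, hux, hvx]

/-- if the non-loop edges of a multiloop-graph form a disjoint union of
isolated edges and triangles (i.e. no open wedge and no 4-clique), and the graph has an
isolated non-loop edge `(p,q)` and a triangle `x, y, z`, then the swap
`(p,q),(x,y) ↝ (p,x),(q,y)` yields a multiloop-graph containing the open wedges `p–x–z`
and `q–y–z`; consequently the graph is connected within the gog to a multiloop-graph with
strictly more self-loops. -/
theorem matching_plus_triangle_not_maximal {V : Type*} [Fintype V] [DecidableEq V]
    (E : Multiset (Sym2 V)) (hE : IsMultiloopGraph E)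
    (hNoWedge : ¬ HasOpenWedge E)
    (hNoK4 : ¬ ∃ a b c d : V, a ≠ b ∧ a ≠ c ∧ a ≠ d ∧ b ≠ c ∧ b ≠ d ∧ c ≠ d ∧
      s(a, b) ∈ E ∧ s(a, c) ∈ E ∧ s(a, d) ∈ E ∧ s(b, c) ∈ E ∧ s(b, d) ∈ E ∧ s(c, d) ∈ E)
    (p q : V) (hpq : p ≠ q) (hpqE : s(p, q) ∈ E)
    (hpiso : ∀ r : V, r ≠ p → r ≠ q → s(p, r) ∉ E)
    (hqiso : ∀ r : V, r ≠ p → r ≠ q → s(q, r) ∉ E)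
    (x y z : V) (hxy : x ≠ y) (hxz : x ≠ z) (hyz : y ≠ z)
    (ht1 : s(x, y) ∈ E) (ht2 : s(y, z) ∈ E) (ht3 : s(x, z) ∈ E) :
    IsMultiloopGraph (E - {s(p, q), s(x, y)} + {s(p, x), s(q, y)}) ∧
      (s(x, p) ∈ E - {s(p, q), s(x, y)} + {s(p, x), s(q, y)} ∧
        s(x, z) ∈ E - {s(p, q), s(x, y)} + {s(p, x), s(q, y)} ∧
        s(p, z) ∉ E - {s(p, q), s(x, y)} + {s(p, x), s(q, y)}) ∧
      (s(y, q) ∈ E - {s(p, q), s(x, y)} + {s(p, x), s(q, y)} ∧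
        s(y, z) ∈ E - {s(p, q), s(x, y)} + {s(p, x), s(q, y)} ∧
        s(q, z) ∉ E - {s(p, q), s(x, y)} + {s(p, x), s(q, y)}) ∧
      (∃ E'' : Multiset (Sym2 V),
        Relation.ReflTransGen (GogAdj (MLGspace (mDeg E))) E E'' ∧
        loopCount E < loopCount E'') := by
  have hiso : ∀ t r₁ r₂ : V, t ≠ r₁ → t ≠ r₂ → r₁ ≠ r₂ → s(t, r₁) ∈ E → s(t, r₂) ∈ E →
      p ≠ t ∧ q ≠ t := by
    intro t r₁ r₂ h₁ h₂ h₁₂ m₁ m₂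
    constructor
    · rintro rfl
      exact h₁₂ ((by_contra fun h => hpiso r₁ h₁.symm h m₁ : r₁ = q).trans
        (by_contra fun h => hpiso r₂ h₂.symm h m₂ : r₂ = q).symm)
    · rintro rfl
      exact h₁₂ ((by_contra fun h => hqiso r₁ h h₁.symm m₁ : r₁ = p).trans
        (by_contra fun h => hqiso r₂ h h₂.symm m₂ : r₂ = p).symm)
  obtain ⟨hpx, hqx⟩ := hiso x y z hxy hxz hyz ht1 ht3
  obtain ⟨hpy, hqy⟩ := hiso y x z hxy.symm hyz hxz (Sym2.eq_swap ▸ ht1) ht2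
  obtain ⟨hpz, hqz⟩ := hiso z x y hxz.symm hyz.symm hxy (Sym2.eq_swap ▸ ht3) (Sym2.eq_swap ▸ ht2)
  have hpx' := hpiso x hpx.symm hqx.symm
  have hqy' := hqiso y hpy.symm hqy.symm
  have hpz' := hpiso z hpz.symm hqz.symm
  have hqz' := hqiso z hpz.symm hqz.symm
  have hle : ({s(p, q), s(x, y)} : Multiset (Sym2 V)) ≤ E :=
    Multiset.pair_le_of_mem hpqE ht1 (by simp [hpx, hpy])
  have hswap : DoubleEdgeSwap E (E - {s(p, q), s(x, y)} + {s(p, x), s(q, y)}) :=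
    ⟨p, q, x, y, hle, rfl⟩
  have hML : IsMultiloopGraph (E - {s(p, q), s(x, y)} + {s(p, x), s(q, y)}) :=
    hE.sub_add_pair _ (.inr hpx') (.inr hqy') (by simp [hpq, hpy])
  have hkeep : ∀ e ∈ E, e ≠ s(p, q) → e ≠ s(x, y) →
      e ∈ E - {s(p, q), s(x, y)} + {s(p, x), s(q, y)} := fun e he h₁ h₂ =>
    Multiset.mem_add.mpr (.inl (Multiset.mem_sub_pair_of_ne he h₁ h₂))
  have hnew : ∀ e, e ∉ E → e ≠ s(p, x) → e ≠ s(q, y) →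
      e ∉ E - {s(p, q), s(x, y)} + {s(p, x), s(q, y)} := by
    intro e he h₁ h₂ h
    rcases Multiset.mem_add.mp h with h | h
    · exact he (Multiset.mem_of_le tsub_le_self h)
    · simp [h₁, h₂] at h
  have hxp : s(x, p) ∈ E - {s(p, q), s(x, y)} + {s(p, x), s(q, y)} := by simp [Sym2.eq_swap]
  have hyq : s(y, q) ∈ E - {s(p, q), s(x, y)} + {s(p, x), s(q, y)} := by simp [Sym2.eq_swap]
  have hxz' := hkeep s(x, z) ht3 (by simp [hpx.symm, hqx.symm]) (by simp [hxy, hyz.symm])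
  have hyz' := hkeep s(y, z) ht2 (by simp [hpy.symm, hqy.symm]) (by simp [hxy.symm, hxz.symm])
  have hpz'' := hnew s(p, z) hpz' (by simp [hpx, hxz.symm]) (by simp [hpq, hpy])
  have hqz'' := hnew s(q, z) hqz' (by simp [hpq.symm, hqx]) (by simp [hqy, hyz.symm])
  refine ⟨hML, ⟨hxp, hxz', hpz''⟩, ⟨hyq, hyz', hqz''⟩, ?_⟩
  have hspace : MLGspace (mDeg E) (E - {s(p, q), s(x, y)} + {s(p, x), s(q, y)}) :=
    ⟨hML, hswap.mDeg_eq⟩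
  obtain ⟨E'', hadj, hcount⟩ := HasOpenWedge.exists_gogAdj_loopCount_eq
    ⟨x, p, z, hpx.symm, hxz, hpz, hxp, hxz', hpz''⟩ hspace
  refine ⟨E'', .head ⟨⟨hE, fun _ => rfl⟩, hspace, .inl hswap⟩ (.single hadj), ?_⟩
  have hsame : loopCount (E - {s(p, q), s(x, y)} + {s(p, x), s(q, y)}) = loopCount E := by
    obtain ⟨F, hF⟩ := Multiset.le_iff_exists_add.mp hle
    simp [hF, loopCount, Multiset.filter_singleton, hpq, hxy, hpx, hqy]
  omega
end

section
/- For every simple graph G1 in the isomorphism class of size 18 and every simple graph G2 in the isomorphism class of size 3 of labeled simple graphs on 8 vertices with degree sequence (3,3,3,3,2,2,2,2) and exactly 4 triangles, the edge sets of G1 and G2 differ in at least 8 edges (i.e., |E(G1) \ E(G2)| ≥ 8). Since a single k edge-swap removes k edges and adds k edges, no single k edge-swap with k < 8 transforms a graph of one class into a graph of the other; hence, for every k ≤ 7, the graph of graphs whose vertices are the 21 simple graphs with this degree sequence and exactly 4 triangles and whose edges are single k edge-swaps is disconnected. -/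
/-! Simple graphs on a labeled finite vertex set, degrees, triangles, triangle sequences. -/

/-- Degree of a vertex in a simple graph. -/
noncomputable def nDeg {V : Type*} (G : SimpleGraph V) (v : V) : ℕ :=
  Nat.card {w : V // G.Adj v w}

/-- `s` is a triangle of `G`: three mutually adjacent vertices. -/
def IsTriangleOf {V : Type*} (G : SimpleGraph V) (s : Finset V) : Prop :=
  s.card = 3 ∧ ∀ a ∈ s, ∀ b ∈ s, a ≠ b → G.Adj a b

/-- Number of triangles of `G`. -/
noncomputable def triCount {V : Type*} (G : SimpleGraph V) : ℕ :=
  Nat.card {s : Finset V // IsTriangleOf G s}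

/-- Number of triangles of `G` containing the vertex `v`. -/
noncomputable def triAt {V : Type*} (G : SimpleGraph V) (v : V) : ℕ :=
  Nat.card {s : Finset V // IsTriangleOf G s ∧ v ∈ s}

/-- The degree sequence `(3,3,3,3,2,2,2,2)`. -/
def dseq8 : Fin 8 → ℕ := ![3, 3, 3, 3, 2, 2, 2, 2]

/-- Simple graphs on 8 vertices with degree sequence `(3,3,3,3,2,2,2,2)` and exactly `t`
triangles. -/
def Space8 (t : ℕ) (G : SimpleGraph (Fin 8)) : Prop :=
  (∀ i, nDeg G i = dseq8 i) ∧ triCount G = t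

/-- A `k` edge-swap: select `k` distinct edges `(a i, b i)` of `G` and cyclically permute
one endpoint in each, so that edge `i` becomes `(a i, b (i+1))` (indices mod `k`). -/
def KEdgeSwap {V : Type*} (k : ℕ) (G G' : SimpleGraph V) : Prop :=
  ∃ a b : Fin k → V, (∀ i, G.Adj (a i) (b i)) ∧
    Function.Injective (fun i => s(a i, b i)) ∧
    G'.edgeSet = (G.edgeSet \ Set.range fun i => s(a i, b i)) ∪
      Set.range fun i : Fin k => s(a i, b ⟨(i.val + 1) % k, Nat.mod_lt _ i.pos⟩)

/-- Adjacency in the graph of graphs on the space `Space8 4` with respect to `k` edge-swaps. -/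
def KSwapAdj (k : ℕ) (G G' : SimpleGraph (Fin 8)) : Prop :=
  Space8 4 G ∧ Space8 4 G' ∧ G ≠ G' ∧ (KEdgeSwap k G G' ∨ KEdgeSwap k G' G)

open Finset in
open scoped Classical in
theorem nDeg_eq_card_filter {n : ℕ} (G : SimpleGraph (Fin n)) (v : Fin n) :
    nDeg G v = #{w | G.Adj v w} := by
  rw [nDeg, Nat.card_eq_fintype_card, Fintype.card_subtype]

theorem nDeg_eq_degree {V : Type*} (G : SimpleGraph V) (v : V) [Fintype (G.neighborSet v)] :
    nDeg G v = G.degree v :=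
  (Nat.card_eq_fintype_card (α := G.neighborSet v)).trans (G.card_neighborSet_eq_degree v)

theorem dseq8_eq (v : Fin 8) : dseq8 v = if v < 4 then 3 else 2 := by
  revert v
  decide

theorem nDeg_iso {V W : Type*} {G : SimpleGraph V} {H : SimpleGraph W} (e : G ≃g H) (v : V) :
    nDeg G v = nDeg H (e v) :=
  Nat.card_congr (e.toEquiv.subtypeEquiv fun _ => e.map_adj_iff.symm)

theorem isTriangleOf_map_iso {V W : Type*} {G : SimpleGraph V} {H : SimpleGraph W} (e : G ≃g H)
    (s : Finset V) : IsTriangleOf G s ↔ IsTriangleOf H (s.map e.toEquiv.toEmbedding) := by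
  simp only [IsTriangleOf, Finset.card_map, Finset.forall_mem_map]
  simp [e.map_adj_iff]

theorem triCount_iso {V W : Type*} {G : SimpleGraph V} {H : SimpleGraph W} (e : G ≃g H) :
    triCount G = triCount H :=
  Nat.card_congr (e.toEquiv.finsetCongr.subtypeEquiv (isTriangleOf_map_iso e))

open scoped Classical in
/-- Triangles through `v` are triangles, so each of the `triCount G` triangles is counted three
times in the sum over vertices. -/
theorem sum_triAt {n : ℕ} (G : SimpleGraph (Fin n)) : ∑ v, triAt G v = 3 * triCount G := by
  have h := Finset.sum_card_bipartiteAbove_eq_sum_card_bipartiteBelow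
    (s := (Finset.univ : Finset (Fin n)))
    (t := Finset.univ.filter (IsTriangleOf G)) (fun v s => v ∈ s)
  have hl : ∀ v, triAt G v =
      (Finset.bipartiteAbove (fun v s => v ∈ s) (Finset.univ.filter (IsTriangleOf G)) v).card := by
    intro v
    rw [triAt, Nat.card_eq_fintype_card, Fintype.card_subtype, Finset.bipartiteAbove,
      Finset.filter_filter]
  rw [Finset.sum_congr rfl fun v _ => hl v, h, triCount, Nat.card_eq_fintype_card,
    Fintype.card_subtype, mul_comm]
  refine Finset.sum_const_nat fun s hs => ?_
  rw [Finset.mem_filter] at hs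
  rw [← hs.2.1, Finset.bipartiteBelow]
  congr 1
  ext
  simp

open scoped Classical in
theorem triAt_le_one {n : ℕ} {G : SimpleGraph (Fin n)} {v : Fin n} (h : nDeg G v = 2) :
    triAt G v ≤ 1 := by
  rw [nDeg_eq_card_filter] at h
  rw [triAt, Nat.card_eq_fintype_card, Fintype.card_subtype, ← Finset.card_singleton
    (insert v (Finset.univ.filter fun w => G.Adj v w))]
  refine Finset.card_le_card fun s hs => ?_
  simp only [Finset.mem_filter, Finset.mem_univ, true_and] at hs
  obtain ⟨⟨hs3, hs⟩, hv⟩ := hs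
  rw [Finset.mem_singleton]
  refine Finset.eq_of_subset_of_card_le (fun w hw => ?_) ?_
  · by_cases hwv : w = v
    · simp [hwv]
    · simp [hs v hv w hw (Ne.symm hwv)]
  · exact (Finset.card_insert_le _ _).trans (by omega)

open scoped Classical in
theorem triAt_le_of_neighbors {n : ℕ} {G : SimpleGraph (Fin n)} {v a b c : Fin n}
    (h : ∀ w, G.Adj v w ↔ w = a ∨ w = b ∨ w = c) :
    triAt G v ≤ (if G.Adj a b then 1 else 0) + (if G.Adj a c then 1 else 0)
      + (if G.Adj b c then 1 else 0) := by
  have key : (Finset.univ.filter fun s => IsTriangleOf G s ∧ v ∈ s) ⊆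
      (if G.Adj a b then {{v, a, b}} else ∅) ∪ (if G.Adj a c then {{v, a, c}} else ∅) ∪
        (if G.Adj b c then {{v, b, c}} else ∅) := by
    intro s hs
    simp only [Finset.mem_filter, Finset.mem_univ, true_and] at hs
    obtain ⟨⟨hs3, hs⟩, hv⟩ := hs
    obtain ⟨x, y, hxy, hsxy⟩ := Finset.card_eq_two.1
      (show (s.erase v).card = 2 by rw [Finset.card_erase_of_mem hv, hs3])
    have hx : x ∈ s.erase v := by simp [hsxy]
    have hy : y ∈ s.erase v := by simp [hsxy]
    have hs' : s = {v, x, y} := by rw [← Finset.insert_erase hv, hsxy]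
    rw [Finset.mem_erase] at hx hy
    have hax := (h x).1 (hs v hv x hx.2 hx.1.symm)
    have hay := (h y).1 (hs v hv y hy.2 hy.1.symm)
    have hadj := hs x hx.2 y hy.2 hxy
    have hcomm : ∀ p q : Fin n, ({v, p, q} : Finset (Fin n)) = {v, q, p} := fun p q => by
      rw [Finset.pair_comm]
    rw [hs']
    rcases hax with rfl | rfl | rfl <;> rcases hay with rfl | rfl | rfl <;>
      simp_all [hadj.symm]
  rw [triAt, Nat.card_eq_fintype_card, Fintype.card_subtype]
  refine (Finset.card_le_card key).trans ?_
  refine (Finset.card_union_le _ _).trans (add_le_add ((Finset.card_union_le _ _).trans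
    (add_le_add ?_ ?_)) ?_) <;> split_ifs <;> simp

/-- The vertices of degree `3` in the degree sequence `dseq8` are mutually adjacent. -/
def CoreIsClique (G : SimpleGraph (Fin 8)) : Prop :=
  ∀ v w : Fin 8, v < 4 → w < 4 → v ≠ w → G.Adj v w

section Space8

variable {t : ℕ} {G : SimpleGraph (Fin 8)}

theorem Space8.nDeg_eq (h : Space8 t G) (v : Fin 8) : nDeg G v = if v < 4 then 3 else 2 := by
  rw [h.1, dseq8_eq]

theorem Space8.exists_neighbors (h : Space8 t G) {v : Fin 8} (hv : v < 4) :
    ∃ a b c, a ≠ b ∧ a ≠ c ∧ b ≠ c ∧ ∀ w, G.Adj v w ↔ w = a ∨ w = b ∨ w = c := by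
  classical
  have hd := h.nDeg_eq v
  rw [nDeg_eq_card_filter, if_pos hv] at hd
  obtain ⟨a, b, c, hab, hac, hbc, hN⟩ := Finset.card_eq_three.1 hd
  refine ⟨a, b, c, hab, hac, hbc, fun w => ?_⟩
  simpa using Finset.ext_iff.1 hN w

/-- A vertex with three distinct neighbors has degree `3`, and has no other neighbor. -/
theorem Space8.of_three_adj (h : Space8 t G) {v a b c : Fin 8} (hab : a ≠ b) (hac : a ≠ c)
    (hbc : b ≠ c) (ha : G.Adj v a) (hb : G.Adj v b) (hc : G.Adj v c) :
    v < 4 ∧ ∀ w, G.Adj v w ↔ w = a ∨ w = b ∨ w = c := by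
  classical
  have hd := h.nDeg_eq v
  rw [nDeg_eq_card_filter] at hd
  have hsub : ({a, b, c} : Finset (Fin 8)) ⊆ Finset.univ.filter fun w => G.Adj v w := by
    intro w hw
    simp only [Finset.mem_insert, Finset.mem_singleton] at hw
    rcases hw with rfl | rfl | rfl <;> simpa
  have h3 : ({a, b, c} : Finset (Fin 8)).card = 3 := Finset.card_eq_three.2
    ⟨a, b, c, hab, hac, hbc, rfl⟩
  have hle := Finset.card_le_card hsub
  have hv : v < 4 := by
    by_contra hv
    rw [if_neg hv] at hd
    omega
  rw [if_pos hv] at hd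
  have heq := Finset.eq_of_subset_of_card_le hsub (by omega)
  refine ⟨hv, fun w => ?_⟩
  simpa using (Finset.ext_iff.1 heq w).symm

theorem CoreIsClique.of_four {v a b c : Fin 8} (h : Space8 t G)
    (hab' : a ≠ b) (hac' : a ≠ c) (hbc' : b ≠ c) (hva : G.Adj v a) (hvb : G.Adj v b)
    (hvc : G.Adj v c) (hab : G.Adj a b) (hac : G.Adj a c) (hbc : G.Adj b c) :
    CoreIsClique G := by
  have hv := (h.of_three_adj hab' hac' hbc' hva hvb hvc).1
  have ha := (h.of_three_adj hvb.ne hvc.ne hbc' hva.symm hab hac).1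
  have hb := (h.of_three_adj hva.ne hvc.ne hac' hvb.symm hab.symm hbc).1
  have hc := (h.of_three_adj hva.ne hvb.ne hab' hvc.symm hac.symm hbc.symm).1
  have hsub : ({v, a, b, c} : Finset (Fin 8)) ⊆ Finset.univ.filter (· < 4) := by
    intro w hw
    simp only [Finset.mem_insert, Finset.mem_singleton] at hw
    rcases hw with rfl | rfl | rfl | rfl <;> simpa
  have h4 : ({v, a, b, c} : Finset (Fin 8)).card = 4 := by
    rw [Finset.card_insert_of_notMem (by simp [hva.ne, hvb.ne, hvc.ne]),
      Finset.card_eq_three.2 ⟨a, b, c, hab', hac', hbc', rfl⟩]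
  have heq := Finset.eq_of_subset_of_card_le hsub (by rw [h4]; decide)
  have hmem : ∀ x : Fin 8, x < 4 → x = v ∨ x = a ∨ x = b ∨ x = c := fun x hx => by
    have : x ∈ ({v, a, b, c} : Finset (Fin 8)) := by rw [heq]; simpa
    simpa using this
  intro x y hx hy hxy
  rcases hmem x hx with rfl | rfl | rfl | rfl <;> rcases hmem y hy with rfl | rfl | rfl | rfl <;>
    first
    | exact absurd rfl hxy
    | assumption
    | (apply SimpleGraph.Adj.symm; assumption)

theorem Space8.triAt_le (h : Space8 t G) (hG : ¬ CoreIsClique G) (v : Fin 8) :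
    triAt G v ≤ if v < 4 then 2 else 1 := by
  classical
  split_ifs with hv
  · obtain ⟨a, b, c, hab, hac, hbc, hN⟩ := h.exists_neighbors hv
    have hle := triAt_le_of_neighbors hN
    by_contra hlt
    refine hG (CoreIsClique.of_four h hab hac hbc ((hN a).2 (by simp)) ((hN b).2 (by simp))
      ((hN c).2 (by simp)) ?_ ?_ ?_) <;> by_contra hn <;> simp only [hn, if_false] at hle <;>
      split_ifs at hle <;> omega
  · exact triAt_le_one (by rw [h.nDeg_eq, if_neg hv])

theorem Space8.triAt_eq (h : Space8 4 G) (hG : ¬ CoreIsClique G) {v : Fin 8} (hv : v < 4) :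
    triAt G v = 2 := by
  have hsum : ∑ v, triAt G v = ∑ v : Fin 8, if v < 4 then 2 else 1 := by
    rw [sum_triAt, h.2]
    decide
  have := (Finset.sum_eq_sum_iff_of_le fun v _ => h.triAt_le hG v).1 hsum v (Finset.mem_univ v)
  rw [this, if_pos hv]

/-- Outside the clique case, every vertex of degree `3` is on the central edge of a diamond. -/
theorem Space8.exists_diamond (h : Space8 4 G) (hG : ¬ CoreIsClique G) {v : Fin 8} (hv : v < 4) :
    ∃ a b c, a ≠ b ∧ a ≠ c ∧ b ≠ c ∧ (∀ w, G.Adj v w ↔ w = a ∨ w = b ∨ w = c) ∧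
      G.Adj a b ∧ G.Adj b c ∧ ¬ G.Adj a c := by
  classical
  obtain ⟨a, b, c, hab, hac, hbc, hN⟩ := h.exists_neighbors hv
  have hle := triAt_le_of_neighbors hN
  rw [h.triAt_eq hG hv] at hle
  have hva := (hN a).2 (by simp)
  have hvb := (hN b).2 (by simp)
  have hvc := (hN c).2 (by simp)
  by_cases h1 : G.Adj a b <;> by_cases h2 : G.Adj a c <;> by_cases h3 : G.Adj b c <;>
    simp only [h1, h2, h3, if_true, if_false] at hle <;> try omega
  · exact absurd (CoreIsClique.of_four h hab hac hbc hva hvb hvc h1 h2 h3) hG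
  · exact ⟨b, a, c, hab.symm, hbc, hac, fun w => by rw [hN]; tauto, h1.symm, h2, h3⟩
  · exact ⟨a, b, c, hab, hac, hbc, hN, h1, h3, h2⟩
  · exact ⟨a, c, b, hac, hab, hbc.symm, fun w => by rw [hN]; tauto, h2, h3.symm, h1⟩

theorem Space8.four_le_of_diamond (h : Space8 4 G) (hG : ¬ CoreIsClique G) {v a b c : Fin 8}
    (hab : a ≠ b) (hac : a ≠ c) (hbc : b ≠ c) (hN : ∀ w, G.Adj v w ↔ w = a ∨ w = b ∨ w = c)
    (h1 : G.Adj a b) (h2 : G.Adj b c) (h3 : ¬ G.Adj a c) : ¬ a < 4 := by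
  intro ha
  have hva := (hN a).2 (by simp)
  have hvb := (hN b).2 (by simp)
  have hvc := (hN c).2 (by simp)
  have hNb := (h.of_three_adj hva.ne hvc.ne hac hvb.symm h1.symm h2).2
  obtain ⟨x, y, z, hxy, hxz, hyz, hNa, h4, h5, h6⟩ := h.exists_diamond hG ha
  have hvN := (hNa v).1 hva.symm
  have hbN := (hNa b).1 h1
  have hc : ∀ w, G.Adj a w → w ≠ v → w ≠ b → ¬ G.Adj w v ∧ ¬ G.Adj w b := by
    intro w haw hwv hwb
    constructor
    · intro hw
      rcases (hN w).1 hw.symm with rfl | rfl | rfl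
      · exact haw.ne rfl
      · exact hwb rfl
      · exact h3 haw
    · intro hw
      rcases (hNb w).1 hw.symm with rfl | rfl | rfl
      · exact hwv rfl
      · exact haw.ne rfl
      · exact h3 haw
  have hx := hc x ((hNa x).2 (by simp))
  have hy := hc y ((hNa y).2 (by simp))
  have hz := hc z ((hNa z).2 (by simp))
  have h4' := h4.symm
  have h5' := h5.symm
  have hvb' := hvb.ne
  rcases hvN with rfl | rfl | rfl <;> rcases hbN with rfl | rfl | rfl <;> simp_all [eq_comm]

/-- Outside the clique case, every vertex of degree `3` has exactly one neighbor of degree `3`. -/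
theorem Space8.exists_core_neighbor (h : Space8 4 G) (hG : ¬ CoreIsClique G) {v : Fin 8}
    (hv : v < 4) : ∃ a b c, a ≠ c ∧ ¬ a < 4 ∧ b < 4 ∧ ¬ c < 4 ∧
      ∀ w, G.Adj v w ↔ w = a ∨ w = b ∨ w = c := by
  obtain ⟨a, b, c, hab, hac, hbc, hN, h1, h2, h3⟩ := h.exists_diamond hG hv
  have hva := (hN a).2 (by simp)
  have hvb := (hN b).2 (by simp)
  have hvc := (hN c).2 (by simp)
  exact ⟨a, b, c, hac, h.four_le_of_diamond hG hab hac hbc hN h1 h2 h3,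
    (h.of_three_adj hva.ne hvc.ne hac hvb.symm h1.symm h2).1,
    h.four_le_of_diamond hG hbc.symm hac.symm hab.symm (fun w => by rw [hN]; tauto) h2.symm h1.symm
      fun hca => h3 hca.symm, hN⟩

/-- Outside the clique case, the vertices of degree `2` are only adjacent to vertices of
degree `3`. -/
theorem Space8.lt_four_of_adj (h : Space8 4 G) (hG : ¬ CoreIsClique G) {u w : Fin 8}
    (hu : ¬ u < 4) (huw : G.Adj u w) : w < 4 := by
  classical
  have hcount := Finset.sum_card_bipartiteAbove_eq_sum_card_bipartiteBelow
    (s := Finset.univ.filter fun v : Fin 8 => v < 4)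
    (t := Finset.univ.filter fun v : Fin 8 => ¬ v < 4) G.Adj
  have hl : ∀ v ∈ Finset.univ.filter fun v : Fin 8 => v < 4,
      (Finset.bipartiteAbove G.Adj (Finset.univ.filter fun v : Fin 8 => ¬ v < 4) v).card = 2 := by
    intro v hv
    obtain ⟨a, b, c, hac, ha, hb, hc, hN⟩ :=
      h.exists_core_neighbor hG (Finset.mem_filter.1 hv).2
    refine Finset.card_eq_two.2 ⟨a, c, hac, ?_⟩
    ext x
    simp only [Finset.mem_bipartiteAbove, Finset.mem_filter, Finset.mem_univ, true_and, hN,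
      Finset.mem_insert, Finset.mem_singleton]
    constructor
    · rintro ⟨hx, rfl | rfl | rfl⟩
      · simp
      · exact absurd hb hx
      · simp
    · rintro (rfl | rfl)
      · simpa using ha
      · simpa using hc
  have hsub : ∀ v, Finset.bipartiteBelow G.Adj (Finset.univ.filter fun v : Fin 8 => v < 4) v ⊆
      Finset.univ.filter fun x => G.Adj v x := by
    intro v x hx
    simp only [Finset.mem_bipartiteBelow, Finset.mem_filter, Finset.mem_univ, true_and] at hx ⊢
    exact hx.2.symm
  have hdeg : ∀ v ∈ Finset.univ.filter fun v : Fin 8 => ¬ v < 4,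
      (Finset.univ.filter fun x => G.Adj v x).card = 2 := by
    intro v hv
    rw [← nDeg_eq_card_filter, h.nDeg_eq, if_neg (Finset.mem_filter.1 hv).2]
  have hr : ∀ v ∈ Finset.univ.filter fun v : Fin 8 => ¬ v < 4,
      (Finset.bipartiteBelow G.Adj (Finset.univ.filter fun v : Fin 8 => v < 4) v).card ≤ 2 :=
    fun v hv => (Finset.card_le_card (hsub v)).trans (hdeg v hv).le
  rw [Finset.sum_congr rfl hl] at hcount
  have hu' : u ∈ Finset.univ.filter fun v : Fin 8 => ¬ v < 4 := by simpa using hu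
  have heq := (Finset.sum_eq_sum_iff_of_le hr).1 (hcount.symm.trans (by decide)) u hu'
  have hset := Finset.eq_of_subset_of_card_le (hsub u) (by rw [heq, hdeg u hu'])
  have hw : w ∈ Finset.univ.filter fun x => G.Adj u x := by simpa using huw
  rw [← hset, Finset.mem_bipartiteBelow, Finset.mem_filter] at hw
  exact hw.1.2

theorem CoreIsClique.lt_four_of_adj (hG : CoreIsClique G) (h : Space8 t G) {v w : Fin 8}
    (hv : v < 4) (hvw : G.Adj v w) : w < 4 := by
  obtain ⟨a, b, c, ha, hb, hc, hav, hbv, hcv, hab, hac, hbc⟩ :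
      ∃ a b c : Fin 8, a < 4 ∧ b < 4 ∧ c < 4 ∧ v ≠ a ∧ v ≠ b ∧ v ≠ c ∧ a ≠ b ∧ a ≠ c ∧ b ≠ c := by
    clear hvw
    revert v
    decide
  rcases ((h.of_three_adj hab hac hbc (hG v a hv ha hav) (hG v b hv hb hbv)
    (hG v c hv hc hcv)).2 w).1 hvw with rfl | rfl | rfl <;> assumption

end Space8

section Distance

variable {G H : SimpleGraph (Fin 8)}

open scoped Classical in
theorem card_common_neighbors_add_two_le (hG : Space8 4 G) (hH : Space8 4 H)
    (hGc : ¬ CoreIsClique G) (hHc : CoreIsClique H) (v : Fin 8) :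
    (Finset.univ.filter fun w => G.Adj v w ∧ H.Adj v w).card + 2 ≤ dseq8 v := by
  rw [dseq8_eq]
  split_ifs with hv
  · obtain ⟨a, b, c, hac, ha, hb, hc, hN⟩ := hG.exists_core_neighbor hGc hv
    have : (Finset.univ.filter fun w => G.Adj v w ∧ H.Adj v w) ⊆ {b} := by
      intro w hw
      simp only [Finset.mem_filter, Finset.mem_univ, true_and] at hw
      have hw4 := hHc.lt_four_of_adj hH hv hw.2
      rcases (hN w).1 hw.1 with rfl | rfl | rfl
      · exact absurd hw4 ha
      · simp
      · exact absurd hw4 hc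
    have := Finset.card_le_card this
    rw [Finset.card_singleton] at this
    omega
  · rw [Finset.filter_eq_empty_iff.2]
    · simp
    · rintro w - ⟨h1, h2⟩
      exact hv (hHc.lt_four_of_adj hH (hG.lt_four_of_adj hGc hv h1) h2.symm)

theorem eight_le_card_sdiff_of_common_neighbors (hdeg : ∀ v, nDeg G v = dseq8 v)
    (h : ∀ v, Nat.card {w // G.Adj v w ∧ H.Adj v w} + 2 ≤ dseq8 v) :
    8 ≤ Nat.card ↥(G.edgeSet \ H.edgeSet) := by
  classical
  have hd : ∀ v, 2 ≤ (G \ H).degree v := by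
    intro v
    rw [← nDeg_eq_degree, nDeg_eq_card_filter]
    have h1 := hdeg v
    have h2 := h v
    rw [nDeg_eq_card_filter,
      ← Finset.card_filter_add_card_filter_not (fun w => H.Adj v w), Finset.filter_filter,
      Finset.filter_filter] at h1
    rw [Nat.card_eq_fintype_card, Fintype.card_subtype] at h2
    simp only [SimpleGraph.sdiff_adj]
    omega
  have hsum := (G \ H).sum_degrees_eq_twice_card_edges
  have hge : ∑ _v : Fin 8, 2 ≤ ∑ v, (G \ H).degree v := Finset.sum_le_sum fun v _ => hd v
  have hcard : ∀ _ : Fintype (G \ H).edgeSet,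
      Nat.card (G \ H).edgeSet = (G \ H).edgeFinset.card :=
    fun _ => Nat.card_eq_fintype_card.trans SimpleGraph.edgeFinset_card.symm
  rw [← hcard] at hsum
  rw [← SimpleGraph.edgeSet_sdiff]
  simp only [Finset.sum_const, Finset.card_univ, Fintype.card_fin, smul_eq_mul] at hge
  omega

theorem eight_le_card_sdiff (hG : Space8 4 G) (hH : Space8 4 H)
    (hGc : ¬ CoreIsClique G) (hHc : CoreIsClique H) :
    8 ≤ Nat.card ↥(G.edgeSet \ H.edgeSet) ∧ 8 ≤ Nat.card ↥(H.edgeSet \ G.edgeSet) := by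
  classical
  have h := card_common_neighbors_add_two_le hG hH hGc hHc
  constructor
  · refine eight_le_card_sdiff_of_common_neighbors hG.1 fun v => ?_
    rw [Nat.card_eq_fintype_card, Fintype.card_subtype]
    exact h v
  · refine eight_le_card_sdiff_of_common_neighbors hH.1 fun v => ?_
    rw [Nat.card_eq_fintype_card, Fintype.card_subtype]
    simpa only [and_comm] using h v

theorem KEdgeSwap.card_sdiff_le {V : Type*} {k : ℕ} {G H : SimpleGraph V}
    (h : KEdgeSwap k G H) : Nat.card ↥(G.edgeSet \ H.edgeSet) ≤ k := by
  obtain ⟨a, b, -, -, hE⟩ := h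
  have hsub : G.edgeSet \ H.edgeSet ⊆ Set.range fun i => s(a i, b i) := by
    rintro e ⟨he, hn⟩
    by_contra hr
    exact hn (hE ▸ Or.inl ⟨he, hr⟩)
  refine (Nat.card_mono (Set.finite_range _) hsub).trans ?_
  simpa using Finite.card_range_le fun i => s(a i, b i)

theorem not_kEdgeSwap (hG : Space8 4 G) (hH : Space8 4 H)
    (hGc : ¬ CoreIsClique G) (hHc : CoreIsClique H) {k : ℕ} (hk : k < 8) :
    ¬ KEdgeSwap k G H ∧ ¬ KEdgeSwap k H G := by
  obtain ⟨h1, h2⟩ := eight_le_card_sdiff hG hH hGc hHc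
  exact ⟨fun h => absurd h.card_sdiff_le (by omega), fun h => absurd h.card_sdiff_le (by omega)⟩

theorem not_reflTransGen_kSwapAdj {k : ℕ} (hk : k < 8) (hGc : ¬ CoreIsClique G)
    (hHc : CoreIsClique H) : ¬ Relation.ReflTransGen (KSwapAdj k) G H := by
  intro h
  induction h with
  | refl => exact hGc hHc
  | @tail b c _ hbc ih =>
    obtain ⟨hb, hc, -, hswap⟩ := hbc
    by_cases hbc : CoreIsClique b
    · exact ih hbc
    · have := not_kEdgeSwap hb hc hbc hHc hk
      tauto

end Distance

section ClassSizes

variable {G H : SimpleGraph (Fin 8)}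

theorem CoreIsClique.of_iso (hG : Space8 4 G) (hH : Space8 4 H) (hGc : CoreIsClique G)
    (e : H ≃g G) : CoreIsClique H := by
  have hlt : ∀ v, v < 4 → e v < 4 := by
    intro v hv
    have := nDeg_iso e v
    rw [hG.nDeg_eq, hH.nDeg_eq, if_pos hv] at this
    by_contra hn
    simp [hn] at this
  intro v w hv hw hvw
  exact e.map_adj_iff.1 (hGc _ _ (hlt v hv) (hlt w hw) (e.injective.ne hvw))

open scoped Classical in
/-- In the clique case the four vertices of degree `2` form a 4-cycle. -/
theorem CoreIsClique.adj_outer (hGc : CoreIsClique G) (hG : Space8 4 G) :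
    (G.Adj 4 7 ↔ ¬ (G.Adj 4 5 ∧ G.Adj 4 6)) ∧ (G.Adj 5 6 ↔ G.Adj 4 7) ∧
      (G.Adj 5 7 ↔ G.Adj 4 6) ∧ (G.Adj 6 7 ↔ G.Adj 4 5) := by
  have hsum : ∀ u : Fin 8, ¬ u < 4 → (if G.Adj u 4 then 1 else 0) + (if G.Adj u 5 then 1 else 0)
      + (if G.Adj u 6 then 1 else 0) + (if G.Adj u 7 then 1 else 0) = 2 := by
    intro u hu
    have hd := hG.nDeg_eq u
    have hn : ∀ v : Fin 8, v < 4 → ¬ G.Adj u v := fun v hv huv =>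
      hu (hGc.lt_four_of_adj hG hv huv.symm)
    rw [nDeg_eq_card_filter, Finset.card_filter, Fin.sum_univ_eight, if_neg hu,
      if_neg (hn 0 (by decide)), if_neg (hn 1 (by decide)), if_neg (hn 2 (by decide)),
      if_neg (hn 3 (by decide))] at hd
    omega
  have h4 := hsum 4 (by decide)
  have h5 := hsum 5 (by decide)
  have h6 := hsum 6 (by decide)
  have h7 := hsum 7 (by decide)
  simp only [G.adj_comm 5 4, G.adj_comm 6 4, G.adj_comm 7 4, G.adj_comm 6 5, G.adj_comm 7 5,
    G.adj_comm 7 6, SimpleGraph.irrefl, if_false] at h4 h5 h6 h7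
  by_cases a : G.Adj 4 5 <;> by_cases b : G.Adj 4 6 <;> by_cases c : G.Adj 4 7 <;>
    by_cases d : G.Adj 5 6 <;> by_cases e : G.Adj 5 7 <;> by_cases f : G.Adj 6 7 <;>
    simp only [a, b, c, d, e, f, if_true, if_false] at h4 h5 h6 h7 ⊢ <;> simp at h4 h5 h6 h7 ⊢

theorem CoreIsClique.ext (hG : Space8 4 G) (hH : Space8 4 H) (hGc : CoreIsClique G)
    (hHc : CoreIsClique H) (h5 : G.Adj 4 5 ↔ H.Adj 4 5) (h6 : G.Adj 4 6 ↔ H.Adj 4 6) :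
    G = H := by
  have hle : ∀ v w : Fin 8, v < w → (G.Adj v w ↔ H.Adj v w) := by
    intro v w hvw
    by_cases hv : v < 4
    · by_cases hw : w < 4
      · exact iff_of_true (hGc v w hv hw hvw.ne) (hHc v w hv hw hvw.ne)
      · exact iff_of_false (fun h => hw (hGc.lt_four_of_adj hG hv h))
          fun h => hw (hHc.lt_four_of_adj hH hv h)
    · obtain ⟨g7, g56, g57, g67⟩ := hGc.adj_outer hG
      obtain ⟨k7, k56, k57, k67⟩ := hHc.adj_outer hH
      have hcases : (v = 4 ∧ w = 5) ∨ (v = 4 ∧ w = 6) ∨ (v = 4 ∧ w = 7) ∨ (v = 5 ∧ w = 6) ∨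
          (v = 5 ∧ w = 7) ∨ (v = 6 ∧ w = 7) := by
        clear * - hvw hv
        revert v w
        decide
      rcases hcases with ⟨rfl, rfl⟩ | ⟨rfl, rfl⟩ | ⟨rfl, rfl⟩ | ⟨rfl, rfl⟩ | ⟨rfl, rfl⟩ |
        ⟨rfl, rfl⟩
      · exact h5
      · exact h6
      · rw [g7, k7, h5, h6]
      · rw [g56, k56, g7, k7, h5, h6]
      · rw [g57, k57, h6]
      · rw [g67, k67, h5]
  ext v w
  rcases lt_trichotomy v w with hvw | rfl | hvw
  · exact hle v w hvw
  · simp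
  · rw [G.adj_comm, H.adj_comm]
    exact hle w v hvw

theorem CoreIsClique.card_class_le (hG : Space8 4 G) (hGc : CoreIsClique G) :
    Nat.card {H : SimpleGraph (Fin 8) // Space8 4 H ∧ Nonempty (H ≃g G)} ≤ 4 := by
  let f : {H : SimpleGraph (Fin 8) // Space8 4 H ∧ Nonempty (H ≃g G)} → Prop × Prop :=
    fun H => (H.1.Adj 4 5, H.1.Adj 4 6)
  have hf : Function.Injective f := by
    rintro ⟨H, hH, ⟨e⟩⟩ ⟨K, hK, ⟨e'⟩⟩ h
    obtain ⟨h1, h2⟩ := Prod.mk.inj h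
    exact Subtype.ext (CoreIsClique.ext hH hK (hGc.of_iso hG hH e) (hGc.of_iso hG hK e')
      (iff_of_eq h1) (iff_of_eq h2))
  refine (Nat.card_le_card_of_injective f hf).trans ?_
  simp [Nat.card_eq_fintype_card]

theorem Space8.comap_swap {t : ℕ} (hG : Space8 t G) {x y : Fin 8} (hxy : x < 4 ↔ y < 4) :
    Space8 t (G.comap (Equiv.swap x y)) := by
  refine ⟨fun v => ?_, (triCount_iso (SimpleGraph.Iso.comap (Equiv.swap x y) G)).trans hG.2⟩
  rw [nDeg_iso (SimpleGraph.Iso.comap (Equiv.swap x y) G) v, hG.1, dseq8_eq, dseq8_eq]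
  have : (Equiv.swap x y v < 4) ↔ v < 4 := by
    rw [Equiv.swap_apply_def]
    split_ifs with h1 h2
    · rw [h1, hxy]
    · rw [h2, hxy]
    · rfl
  simp [this]

theorem Space8.four_le_card_class (hG : Space8 4 G) (hGc : ¬ CoreIsClique G) :
    4 ≤ Nat.card {H : SimpleGraph (Fin 8) // Space8 4 H ∧ Nonempty (H ≃g G)} := by
  obtain ⟨a, m, c, hac, ha, hm, hc, hN⟩ := hG.exists_core_neighbor hGc (v := 0) (by decide)
  have hm0 : m ≠ 0 := (G.ne_of_adj ((hN m).2 (by simp))).symm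
  obtain ⟨m', m'', h1, h2, h3, h4, h5, h6, h7⟩ : ∃ m' m'' : Fin 8, m' < 4 ∧ m'' < 4 ∧ m' ≠ 0 ∧
      m'' ≠ 0 ∧ m' ≠ m ∧ m'' ≠ m ∧ m' ≠ m'' := by
    clear hN
    revert m
    decide
  obtain ⟨u, hu, hua, huc⟩ : ∃ u : Fin 8, ¬ u < 4 ∧ u ≠ a ∧ u ≠ c := by
    clear * -
    revert a c
    decide
  have hlt : ∀ {x y : Fin 8}, ¬ x < 4 → y < 4 → x ≠ y := by
    rintro x y hx hy rfl
    exact hx hy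
  have ha0 := hlt ha (y := 0) (by decide)
  have hu0 := hlt hu (y := 0) (by decide)
  have hadj : ∀ {x y : Fin 8}, x ≠ 0 → y ≠ 0 → ∀ w,
      (G.comap (Equiv.swap x y)).Adj 0 w ↔ G.Adj 0 (Equiv.swap x y w) := by
    intro x y hx hy w
    rw [SimpleGraph.comap_adj, Equiv.swap_apply_of_ne_of_ne hx.symm hy.symm]
  let C := {H : SimpleGraph (Fin 8) // Space8 4 H ∧ Nonempty (H ≃g G)}
  let g : ∀ x y : Fin 8, (x < 4 ↔ y < 4) → C := fun x y h =>
    ⟨G.comap (Equiv.swap x y), hG.comap_swap h, ⟨SimpleGraph.Iso.comap (Equiv.swap x y) G⟩⟩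
  have p0 : (0 : Fin 8) < 4 ↔ (0 : Fin 8) < 4 := Iff.rfl
  have p1 : a < 4 ↔ u < 4 := iff_of_false ha hu
  have p2 : m < 4 ↔ m' < 4 := iff_of_true hm h1
  have p3 : m < 4 ↔ m'' < 4 := iff_of_true hm h2
  let f : Fin 4 → C := ![g 0 0 p0, g a u p1, g m m' p2,
    g m m'' p3]
  have hne : ∀ {x y x' y' : Fin 8} (h : x < 4 ↔ y < 4) (h' : x' < 4 ↔ y' < 4) (w : Fin 8), (¬ ((G.comap (Equiv.swap x y)).Adj 0 w ↔
      (G.comap (Equiv.swap x' y')).Adj 0 w)) → g x y h ≠ g x' y' h' := by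
    intro x y x' y' h h' w hn heq
    exact hn (by rw [show G.comap (Equiv.swap x y) = _ from congrArg Subtype.val heq])
  have hG0 : ∀ w, (G.comap (Equiv.swap (0 : Fin 8) 0)).Adj 0 w ↔ G.Adj 0 w := fun w => by simp
  have hsm : ∀ {x : Fin 8}, x < 4 → Equiv.swap a u x = x := fun hx =>
    Equiv.swap_apply_of_ne_of_ne (hlt ha hx).symm (hlt hu hx).symm
  have e01 : g 0 0 p0 ≠ g a u p1 := hne p0 p1 a (by
    rw [hG0, hadj ha0 hu0, Equiv.swap_apply_left, hN, hN]
    simp [hua, huc, hlt hu hm])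
  have e02 : g 0 0 p0 ≠ g m m' p2 := hne p0 p2 m (by
    rw [hG0, hadj hm0 h3, Equiv.swap_apply_left, hN, hN]
    simp [h5, (hlt ha h1).symm, (hlt hc h1).symm])
  have e03 : g 0 0 p0 ≠ g m m'' p3 := hne p0 p3 m (by
    rw [hG0, hadj hm0 h4, Equiv.swap_apply_left, hN, hN]
    simp [h6, (hlt ha h2).symm, (hlt hc h2).symm])
  have e12 : g a u p1 ≠ g m m' p2 := hne p1 p2 m (by
    rw [hadj ha0 hu0, hadj hm0 h3, Equiv.swap_apply_left, hsm hm, hN, hN]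
    simp [h5, (hlt ha h1).symm, (hlt hc h1).symm])
  have e13 : g a u p1 ≠ g m m'' p3 := hne p1 p3 m (by
    rw [hadj ha0 hu0, hadj hm0 h4, Equiv.swap_apply_left, hsm hm, hN, hN]
    simp [h6, (hlt ha h2).symm, (hlt hc h2).symm])
  have e23 : g m m' p2 ≠ g m m'' p3 := hne p2 p3 m' (by
    rw [hadj hm0 h3, hadj hm0 h4, Equiv.swap_apply_right, Equiv.swap_apply_of_ne_of_ne h5 h7,
      hN, hN]
    simp [h5, (hlt ha h1).symm, (hlt hc h1).symm])
  have hf : Function.Injective f := by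
    intro i j hij
    fin_cases i <;> fin_cases j <;>
      first
      | rfl
      | exact absurd hij ‹_ ≠ _›
      | exact absurd hij.symm ‹_ ≠ _›
  simpa using Nat.card_le_card_of_injective f hf

end ClassSizes

/-- any member `G₁` of the isomorphism class of size 18 and any member `G₂`
of the isomorphism class of size 3 (of graphs with degree sequence `(3,3,3,3,2,2,2,2)` and
4 triangles) differ in at least 8 edges; no single `k` edge-swap with `k < 8` transforms
one into the other; hence for every `k ≤ 7` the graph of graphs of this space under `k`
edge-swaps is disconnected. -/
theorem kswap_disconnected_deg33332222 (G₁ G₂ : SimpleGraph (Fin 8))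
    (h₁ : Space8 4 G₁) (h₂ : Space8 4 G₂)
    (hc₁ : Nat.card {G : SimpleGraph (Fin 8) // Space8 4 G ∧ Nonempty (G ≃g G₁)} = 18)
    (hc₂ : Nat.card {G : SimpleGraph (Fin 8) // Space8 4 G ∧ Nonempty (G ≃g G₂)} = 3) :
    8 ≤ Nat.card ↥(G₁.edgeSet \ G₂.edgeSet) ∧
      (∀ k : ℕ, k < 8 → ¬ KEdgeSwap k G₁ G₂ ∧ ¬ KEdgeSwap k G₂ G₁) ∧
      (∀ k : ℕ, k ≤ 7 → ∃ A B : SimpleGraph (Fin 8), Space8 4 A ∧ Space8 4 B ∧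
        ¬ Relation.ReflTransGen (KSwapAdj k) A B) := by
  have hK₁ : ¬ CoreIsClique G₁ := fun hK => by
    have := hK.card_class_le h₁
    omega
  have hK₂ : CoreIsClique G₂ := by
    by_contra hK
    have := h₂.four_le_card_class hK
    omega
  exact ⟨(eight_le_card_sdiff h₁ h₂ hK₁ hK₂).1, fun k hk => not_kEdgeSwap h₁ h₂ hK₁ hK₂ hk,
    fun k hk => ⟨G₁, G₂, h₁, h₂, not_reflTransGen_kSwapAdj (by omega) hK₁ hK₂⟩⟩
end
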